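/- A finitely generated group is amenable if and only if every branching random walk with mean offspring m > 1 on its Cayley graph is recurrent. -/

import Mathlib

open MeasureTheory
open scoped ENNReal symmDiff

/-- Offspring number of particle `v` (Ulam–Harris encoding, child `i :: v` of `v`). -/
def offspring {β : Type*} (ω : List ℕ → ℕ × β) (v : List ℕ) : ℕ := (ω v).1

/-- The particle `v` is alive (belongs to the Galton–Watson family tree). -/
def alive {β : Type*} (ω : List ℕ → ℕ × β) : List ℕ → Prop
  | [] => True
  | i :: v => i < offspring ω v ∧ alive ω v

/-- Position of the particle `v` of the branching random walk on the group `Γ`: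
the product of the i.i.d. generator labels along the ancestry line. -/
def posG {Γ : Type*} [Group Γ] (ω : List ℕ → ℕ × Γ) : List ℕ → Γ
  | [] => 1
  | i :: v => posG ω v * (ω (i :: v)).2

/-- `P` is the product of the probability measures `ν i` over the coordinates `i : ι`. -/
def IsProductWith {ι α : Type*} [MeasurableSpace α] (ν : ι → Measure α)
    (P : Measure (ι → α)) : Prop :=
  IsProbabilityMeasure P ∧
    ∀ s : Finset ι,
      Measure.map (fun ω (i : s) => ω i) P = Measure.pi (fun i : s => ν i)

/-- The uniform probability measure on a finite set `S` of group elements. -/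
noncomputable def unifS {Γ : Type*} [MeasurableSpace Γ] (S : Finset Γ) : Measure Γ :=
  ((S.card : ℝ≥0∞))⁻¹ • ∑ s ∈ S, Measure.dirac s

/-- Amenability of a group via the Følner condition. -/
def IsAmenableGrp (Γ : Type*) [Group Γ] [DecidableEq Γ] : Prop :=
  ∀ T : Finset Γ, ∀ ε : ℝ, 0 < ε → ∃ F : Finset Γ, F.Nonempty ∧
    ∀ g ∈ T, (((F.image fun x => g * x) ∆ F).card : ℝ) ≤ ε * F.card

/-- The branching random walk on `Γ` is recurrent: with positive probability some group
element is visited infinitely often. -/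
def BRWRecurrent {Γ : Type*} [Group Γ] [MeasurableSpace Γ]
    (P : Measure (List ℕ → ℕ × Γ)) : Prop :=
  0 < P {ω | ∃ x : Γ, {v : List ℕ | alive ω v ∧ posG ω v = x}.Infinite}

open ProbabilityTheory

/-- The subtree configuration rooted at the `i`-th child of the root. -/
def subtree {β : Type*} (i : ℕ) (ω : List ℕ → β) : List ℕ → β := fun w => ω (w ++ [i])

lemma measurable_subtree {β : Type*} [MeasurableSpace β] (i : ℕ) :
    Measurable (subtree (β := β) i) :=
  measurable_pi_lambda _ fun _ => measurable_pi_apply _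

lemma IsProductWith.eq_infinitePi {ι α : Type*} [MeasurableSpace α] {ν : ι → Measure α}
    [∀ i, IsProbabilityMeasure (ν i)] {P : Measure (ι → α)} (h : IsProductWith ν P) :
    P = Measure.infinitePi ν := by
  have hP : IsProjectiveLimit P fun I : Finset ι => Measure.pi fun i : I => ν i := h.2
  exact hP.unique (Measure.isProjectiveLimit_infinitePi ν)

lemma isProductWith_infinitePi {ι α : Type*} [MeasurableSpace α] (ν : ι → Measure α)
    [∀ i, IsProbabilityMeasure (ν i)] : IsProductWith ν (Measure.infinitePi ν) :=
  ⟨inferInstance, fun s => Measure.isProjectiveLimit_infinitePi ν s⟩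

/-- The subtrees rooted at the children of the root are i.i.d. copies of the whole tree. -/
lemma map_subtrees {β : Type*} [MeasurableSpace β] (ν : Measure β) [IsProbabilityMeasure ν] :
    (Measure.infinitePi fun _ : List ℕ => ν).map (fun ω i => subtree i ω) =
      Measure.infinitePi fun _ : ℕ => Measure.infinitePi fun _ : List ℕ => ν := by
  have hf : Function.Injective fun q : ℕ × List ℕ => q.2 ++ [q.1] := by
    rintro ⟨i, w⟩ ⟨j, v⟩ h
    obtain ⟨h₁, h₂⟩ := List.append_inj' h rfl
    simp_all
  rw [← Measure.infinitePi_map_curry fun (_ : ℕ) (_ : List ℕ) => ν,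
    ← Measure.map_infinitePi_infinitePi_of_inj (P := fun _ : List ℕ => ν) hf,
    Measure.map_map (by fun_prop) (by fun_prop)]
  rfl

lemma measure_root_subtrees {β : Type*} [MeasurableSpace β] (ν : Measure β)
    [IsProbabilityMeasure ν] {A : Set β} (hA : MeasurableSet A) (I : Finset ℕ)
    {D : Set (List ℕ → β)} (hD : MeasurableSet D) :
    (Measure.infinitePi fun _ : List ℕ => ν) {ω | ω [] ∈ A ∧ ∀ i ∈ I, subtree i ω ∈ D} =
      ν A * (Measure.infinitePi fun _ : List ℕ => ν) D ^ I.card := by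
  set π := Measure.infinitePi fun _ : List ℕ => ν with hπ
  have hind : iIndep (fun l : List ℕ => MeasurableSpace.comap (fun ω : List ℕ → β => ω l) ‹_›) π :=
    iIndepFun_infinitePi (P := fun _ : List ℕ => ν) (X := fun _ x => x) fun _ => measurable_id
  have h := indep_iSup_of_disjoint (fun l => (measurable_pi_apply l).comap_le) hind
    (S := {[]}) (T := {[]}ᶜ) disjoint_compl_right
  rw [Indep_iff] at h
  have h₁ : MeasurableSet[⨆ l ∈ ({[]} : Set (List ℕ)),
      MeasurableSpace.comap (fun ω : List ℕ → β => ω l) ‹_›] {ω | ω [] ∈ A} := by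
    rw [iSup_singleton]
    exact ⟨A, hA, rfl⟩
  have h₂ : MeasurableSet[⨆ l ∈ ({[]}ᶜ : Set (List ℕ)),
      MeasurableSpace.comap (fun ω : List ℕ → β => ω l) ‹_›]
        {ω | ∀ i ∈ I, subtree i ω ∈ D} := by
    have : {ω : List ℕ → β | ∀ i ∈ I, subtree i ω ∈ D} = ⋂ i ∈ I, subtree i ⁻¹' D := by
      ext; simp
    rw [this]
    refine Finset.measurableSet_biInter _ fun i _ => ?_
    suffices hm : Measurable[⨆ l ∈ ({[]}ᶜ : Set (List ℕ)),
      MeasurableSpace.comap (fun ω : List ℕ → β => ω l) ‹_›] (subtree (β := β) i) from hm hD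
    refine @measurable_pi_lambda _ _ _ (_) _ _ fun w => ?_
    rw [measurable_iff_comap_le]
    exact le_iSup₂_of_le (w ++ [i]) (by simp) le_rfl
  have h₃ : π {ω | ω [] ∈ A} = ν A := by
    have := Measure.infinitePi_map_eval (fun _ : List ℕ => ν) []
    rw [← this, Measure.map_apply (measurable_pi_apply _) hA]
    rfl
  have h₄ : π {ω | ∀ i ∈ I, subtree i ω ∈ D} = π D ^ I.card := by
    have h := Measure.infinitePi_pi (fun _ : ℕ => π) (s := I) (t := fun _ => D) fun _ _ => hD
    rw [Finset.prod_const, ← map_subtrees, Measure.map_apply] at h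
    · exact h
    · exact measurable_pi_lambda _ fun i => measurable_subtree i
    · exact MeasurableSet.pi I.countable_toSet fun _ _ => hD
  rw [← h₃, ← h₄, ← h _ _ h₁ h₂]
  rfl

lemma measurableSet_subtrees {β : Type*} [MeasurableSpace β] [Countable β]
    [MeasurableSingletonClass β] (I : β → Finset ℕ) {D : β → Set (List ℕ → β)}
    (hD : ∀ a, MeasurableSet (D a)) :
    MeasurableSet {ω : List ℕ → β | ∀ i ∈ I (ω []), subtree i ω ∈ D (ω [])} := by
  have : {ω : List ℕ → β | ∀ i ∈ I (ω []), subtree i ω ∈ D (ω [])} =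
      ⋃ a : β, ({ω | ω [] = a} ∩ ⋂ i ∈ I a, subtree i ⁻¹' D a) := by
    ext ω; simp
  rw [this]
  refine MeasurableSet.iUnion fun a => ?_
  exact (measurable_pi_apply _ (measurableSet_singleton a)).inter
    (Finset.measurableSet_biInter _ fun i _ => measurable_subtree i (hD a))

/-- Decomposition of a tree event at the root. -/
lemma measure_subtrees_eq_lintegral {β : Type*} [MeasurableSpace β] [Countable β]
    [MeasurableSingletonClass β] (ν : Measure β) [IsProbabilityMeasure ν]
    (I : β → Finset ℕ) {D : β → Set (List ℕ → β)} (hD : ∀ a, MeasurableSet (D a)) :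
    (Measure.infinitePi fun _ : List ℕ => ν)
        {ω | ∀ i ∈ I (ω []), subtree i ω ∈ D (ω [])} =
      ∫⁻ a, (Measure.infinitePi fun _ : List ℕ => ν) (D a) ^ (I a).card ∂ν := by
  set π := Measure.infinitePi fun _ : List ℕ => ν with hπ
  have : {ω : List ℕ → β | ∀ i ∈ I (ω []), subtree i ω ∈ D (ω [])} =
      ⋃ a : β, {ω | ω [] ∈ ({a} : Set β) ∧ ∀ i ∈ I a, subtree i ω ∈ D a} := by
    ext ω; simp
  rw [this, measure_iUnion, lintegral_countable']
  · refine tsum_congr fun a => ?_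
    rw [measure_root_subtrees ν (measurableSet_singleton a) (I a) (hD a), mul_comm]
  · intro a b hab
    refine Set.disjoint_left.2 fun ω h₁ h₂ => hab ?_
    exact (Set.mem_singleton_iff.1 h₁.1).symm.trans (Set.mem_singleton_iff.1 h₂.1)
  · intro a
    have : {ω : List ℕ → β | ω [] ∈ ({a} : Set β) ∧ ∀ i ∈ I a, subtree i ω ∈ D a} =
        {ω | ω [] ∈ ({a} : Set β)} ∩ ⋂ i ∈ I a, subtree i ⁻¹' D a := by
      ext ω; simp
    rw [this]
    exact (measurable_pi_apply _ (measurableSet_singleton a)).inter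
      (Finset.measurableSet_biInter _ fun i _ => measurable_subtree i (hD a))

lemma alive_append_singleton {β : Type*} (ω : List ℕ → ℕ × β) (w : List ℕ) (i : ℕ) :
    alive ω (w ++ [i]) ↔ i < (ω []).1 ∧ alive (subtree i ω) w := by
  induction w with
  | nil => simp [alive, offspring]
  | cons j w ih =>
    simp only [List.cons_append, alive, ih, offspring, subtree]
    tauto

lemma posG_append_singleton {Γ : Type*} [Group Γ] (ω : List ℕ → ℕ × Γ) (w : List ℕ) (i : ℕ) :
    posG ω (w ++ [i]) = (subtree i ω []).2 * posG (subtree i ω) w := by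
  induction w with
  | nil => simp [posG, subtree]
  | cons j w ih => simp only [List.cons_append, posG, ih, subtree, mul_assoc]

lemma lintegral_unifS {Γ : Type*} [MeasurableSpace Γ] [MeasurableSingletonClass Γ]
    (S : Finset Γ) (f : Γ → ℝ≥0∞) :
    ∫⁻ s, f s ∂unifS S = (S.card : ℝ≥0∞)⁻¹ * ∑ s ∈ S, f s := by
  simp [unifS, lintegral_smul_measure, lintegral_finsetSum_measure]

lemma isProbabilityMeasure_unifS {Γ : Type*} [MeasurableSpace Γ] {S : Finset Γ}
    (hS : S.Nonempty) : IsProbabilityMeasure (unifS S) := by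
  constructor
  simp only [unifS, Measure.smul_apply, Measure.coe_finsetSum, Finset.sum_apply, measure_univ,
    Finset.sum_const, smul_eq_mul, nsmul_eq_mul, mul_one]
  exact ENNReal.inv_mul_cancel (by simpa using hS.ne_empty) (ENNReal.natCast_ne_top _)

lemma lintegral_offspring_unifS {Γ : Type*} [MeasurableSpace Γ] [MeasurableSingletonClass Γ]
    [Countable Γ] (p : PMF ℕ) {S : Finset Γ} (hS : S.Nonempty) (f : ℕ × Γ → ℝ≥0∞) :
    ∫⁻ a, f a ∂(p.toMeasure.prod (unifS S)) =
      (S.card : ℝ≥0∞)⁻¹ * ∑ s ∈ S, ∑' k, p k * f (k, s) := by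
  have := isProbabilityMeasure_unifS hS
  rw [lintegral_prod_symm _ (measurable_of_countable f).aemeasurable, lintegral_unifS]
  congr 1
  refine Finset.sum_congr rfl fun s _ => ?_
  rw [lintegral_countable']
  refine tsum_congr fun k => ?_
  rw [PMF.toMeasure_apply_singleton _ _ (measurableSet_singleton k), mul_comm]

lemma one_sub_pow_le {t : ℝ} (h₀ : 0 ≤ t) (h₁ : t ≤ 1) (k : ℕ) :
    (1 - t) ^ k ≤ 1 - k * t + (k : ℝ) ^ 2 * t ^ 2 := by
  induction k with
  | zero => simp
  | succ k ih =>
    have h := mul_le_mul_of_nonneg_right ih (sub_nonneg.2 h₁)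
    rw [pow_succ]
    push_cast
    have : 0 ≤ (k : ℝ) ^ 2 * t ^ 3 := by positivity
    have : 0 ≤ ((k : ℝ) + 1) * t ^ 2 := by positivity
    nlinarith

/-- The generating function of an offspring law with mean larger than one lies, near `1`, below
a line through `(1, 1)` of slope larger than one. -/
lemma exists_generating_function_le (p : PMF ℕ) (hm : 1 < ∑' k : ℕ, (k : ℝ≥0∞) * p k) :
    ∃ m t₀ : ℝ, 1 < m ∧ 0 < t₀ ∧ t₀ ≤ 1 ∧ ∀ t, 0 ≤ t → t ≤ t₀ →
      ∑' k : ℕ, p k * ENNReal.ofReal (1 - t) ^ k ≤ ENNReal.ofReal (1 - m * t) := by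
  rw [ENNReal.tsum_eq_iSup_sum, lt_iSup_iff] at hm
  obtain ⟨T, hT⟩ := hm
  set q : ℕ → ℝ := fun k => (p k).toReal with hq
  have hq0 : ∀ k, 0 ≤ q k := fun k => ENNReal.toReal_nonneg
  have hpq : ∀ k, p k = ENNReal.ofReal (q k) := fun k =>
    (ENNReal.ofReal_toReal (p.apply_ne_top k)).symm
  have hqs : HasSum q 1 := by
    have h := ENNReal.hasSum_toReal (f := p) (by rw [p.tsum_coe]; exact ENNReal.one_ne_top)
    rwa [← ENNReal.tsum_toReal_eq (fun k => p.apply_ne_top k), p.tsum_coe,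
      ENNReal.toReal_one] at h
  set M := ∑ k ∈ T, (k : ℝ) * q k with hM
  set C := ∑ k ∈ T, (k : ℝ) ^ 2 * q k with hC
  have hC0 : 0 ≤ C := Finset.sum_nonneg fun k _ => mul_nonneg (by positivity) (hq0 k)
  have hM1 : 1 < M := by
    have : ∑ k ∈ T, (k : ℝ≥0∞) * p k = ENNReal.ofReal M := by
      rw [hM, ENNReal.ofReal_sum_of_nonneg fun k _ => mul_nonneg (by positivity) (hq0 k)]
      refine Finset.sum_congr rfl fun k _ => ?_
      rw [ENNReal.ofReal_mul (by positivity), ENNReal.ofReal_natCast, hpq]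
    rw [this] at hT
    exact ENNReal.one_lt_ofReal.1 hT
  refine ⟨(1 + M) / 2, min 1 ((M - 1) / (2 * (C + 1))), by linarith, ?_, min_le_left _ _, ?_⟩
  · exact lt_min one_pos (div_pos (by linarith) (by linarith))
  intro t ht0 ht
  have ht1 : t ≤ 1 := ht.trans (min_le_left _ _)
  have ht2 : t * (2 * (C + 1)) ≤ M - 1 :=
    (le_div_iff₀ (by linarith)).1 (ht.trans (min_le_right _ _))
  have hpow0 : ∀ k : ℕ, 0 ≤ (1 - t) ^ k := fun k => pow_nonneg (by linarith) k
  have hpow1 : ∀ k : ℕ, (1 - t) ^ k ≤ 1 := fun k => pow_le_one₀ (by linarith) (by linarith)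
  have hsum : Summable fun k => q k * (1 - t) ^ k :=
    hqs.summable.of_nonneg_of_le (fun k => mul_nonneg (hq0 k) (hpow0 k))
      fun k => mul_le_of_le_one_right (hq0 k) (hpow1 k)
  have hT' : HasSum (fun k => if k ∈ T then q k * (k * t - (k : ℝ) ^ 2 * t ^ 2) else 0)
      (M * t - C * t ^ 2) := by
    have : M * t - C * t ^ 2 =
        ∑ k ∈ T, (if k ∈ T then q k * (k * t - (k : ℝ) ^ 2 * t ^ 2) else 0) := by
      rw [hM, hC, Finset.sum_mul, Finset.sum_mul, ← Finset.sum_sub_distrib]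
      refine Finset.sum_congr rfl fun k hk => ?_
      rw [if_pos hk]; ring
    rw [this]
    exact hasSum_sum_of_ne_finset_zero fun k hk => if_neg hk
  have hle : ∑' k, q k * (1 - t) ^ k ≤ 1 - (M * t - C * t ^ 2) := by
    refine hasSum_le (fun k => ?_) hsum.hasSum (hqs.sub hT')
    split_ifs
    · nlinarith [mul_le_mul_of_nonneg_left (one_sub_pow_le ht0 ht1 k) (hq0 k)]
    · simpa using mul_le_of_le_one_right (hq0 k) (hpow1 k)
  calc ∑' k : ℕ, p k * ENNReal.ofReal (1 - t) ^ k
      = ∑' k : ℕ, ENNReal.ofReal (q k * (1 - t) ^ k) := by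
        refine tsum_congr fun k => ?_
        rw [ENNReal.ofReal_mul (hq0 k), ENNReal.ofReal_pow (by linarith), hpq]
    _ = ENNReal.ofReal (∑' k, q k * (1 - t) ^ k) :=
        (ENNReal.ofReal_tsum_of_nonneg (fun k => mul_nonneg (hq0 k) (hpow0 k)) hsum).symm
    _ ≤ _ := ENNReal.ofReal_le_ofReal (hle.trans (by nlinarith))

/-- A nonnegative symmetric matrix whose entries sum to at least `c` times its size has a
nonnegative nonzero vector `v` with `c • v ≤ A *ᵥ v`. -/
lemma exists_nonneg_le_mulVec {ι : Type*} [Fintype ι] [Nonempty ι] (A : ι → ι → ℝ)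
    (hA0 : ∀ i j, 0 ≤ A i j) (hsymm : ∀ i j, A i j = A j i) {c : ℝ}
    (hc : c * Fintype.card ι ≤ ∑ i, ∑ j, A i j) :
    ∃ v : ι → ℝ, (∀ i, 0 ≤ v i) ∧ (∃ i, 0 < v i) ∧ ∀ i, c * v i ≤ ∑ j, A i j * v j := by
  classical
  set Q : (ι → ℝ) → ℝ := fun v => ∑ i, v i * ∑ j, A i j * v j with hQ
  set K : Set (ι → ℝ) := {v | (∀ i, 0 ≤ v i) ∧ ∑ i, v i ^ 2 = 1} with hK
  have hKc : IsCompact K := by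
    refine (isCompact_Icc (a := (0 : ι → ℝ)) (b := 1)).of_isClosed_subset ?_ ?_
    · refine IsClosed.inter ?_ ?_
      · have : {v : ι → ℝ | ∀ i, 0 ≤ v i} = ⋂ i, {v | 0 ≤ v i} := by ext; simp
        change IsClosed {v : ι → ℝ | ∀ i, 0 ≤ v i}
        rw [this]
        exact isClosed_iInter fun i => isClosed_le continuous_const (continuous_apply i)
      · exact isClosed_eq (by fun_prop) continuous_const
    · rintro v ⟨h0, h1⟩
      refine ⟨h0, fun i => ?_⟩
      have : v i ^ 2 ≤ 1 :=
        h1 ▸ Finset.single_le_sum (f := fun i => v i ^ 2) (fun i _ => sq_nonneg _)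
          (Finset.mem_univ i)
      exact (sq_le_one_iff₀ (h0 i)).1 this
  set n : ℝ := ((Fintype.card ι : ℕ) : ℝ) with hn
  have hn0 : 0 < n := by rw [hn]; exact_mod_cast Fintype.card_pos
  have hsq : (√n)⁻¹ * (√n)⁻¹ = n⁻¹ := by rw [← mul_inv, Real.mul_self_sqrt hn0.le]
  have hmem : (fun _ => (√n)⁻¹ : ι → ℝ) ∈ K := by
    refine ⟨fun i => by positivity, ?_⟩
    simp only [sq, hsq, Finset.sum_const, Finset.card_univ, nsmul_eq_mul]
    exact mul_inv_cancel₀ hn0.ne'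
  obtain ⟨v, ⟨hv0, hv1⟩, hmax⟩ :=
    hKc.exists_isMaxOn ⟨_, hmem⟩ (f := Q) (by fun_prop)
  have hcμ : c ≤ Q v := by
    have h := hmax hmem
    have h' : Q (fun _ => (√n)⁻¹) = n⁻¹ * ∑ i, ∑ j, A i j := by
      simp only [hQ, ← Finset.sum_mul, ← Finset.mul_sum]
      rw [← hsq]; ring
    simp only [Set.mem_ofPred_eq] at h
    rw [h'] at h
    refine le_trans ?_ h
    rw [inv_mul_eq_div, le_div_iff₀ hn0]
    exact hc
  set μ := Q v with hμ
  have hμw : ∀ w : ι → ℝ, (∀ i, 0 ≤ w i) → 0 < ∑ i, w i ^ 2 → Q w ≤ μ * ∑ i, w i ^ 2 := by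
    intro w hw hN
    set N := ∑ i, w i ^ 2 with hN'
    have hs : (√N)⁻¹ * (√N)⁻¹ = N⁻¹ := by rw [← mul_inv, Real.mul_self_sqrt hN.le]
    have hm : (fun i => (√N)⁻¹ * w i) ∈ K := by
      refine ⟨fun i => mul_nonneg (by positivity) (hw i), ?_⟩
      simp only [mul_pow, ← Finset.mul_sum]
      rw [sq, hs, ← hN', inv_mul_cancel₀ hN.ne']
    have h := hmax hm
    have h' : Q (fun i => (√N)⁻¹ * w i) = N⁻¹ * Q w := by
      simp only [hQ, Finset.mul_sum]
      refine Finset.sum_congr rfl fun i _ => Finset.sum_congr rfl fun j _ => ?_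
      rw [← hs]; ring
    simp only [Set.mem_ofPred_eq] at h
    rw [h', inv_mul_eq_div, div_le_iff₀ hN] at h
    exact h
  set B : ι → ℝ := fun i => ∑ j, A i j * v j with hB
  have hQadd : ∀ i (t : ℝ), Q (v + t • Pi.single i 1) = μ + 2 * t * B i + t ^ 2 * A i i := by
    intro i t
    have h1 : ∀ k, ∑ j, A k j * (v + t • Pi.single i 1 : ι → ℝ) j = B k + t * A k i := by
      intro k
      simp [hB, mul_add, Finset.sum_add_distrib, Pi.single_apply, mul_comm]
    simp only [hQ, h1]
    have h2 : ∑ k, v k * A k i = B i := by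
      simp only [hB]
      exact Finset.sum_congr rfl fun k _ => by rw [hsymm, mul_comm]
    have h3 : ∀ k, (v + t • Pi.single i 1 : ι → ℝ) k * (B k + t * A k i) =
        v k * B k + t * (v k * A k i) + (if k = i then t * (B k + t * A k i) else 0) := by
      intro k
      simp only [Pi.add_apply, Pi.smul_apply, Pi.single_apply, smul_eq_mul]
      split_ifs <;> ring
    simp only [h3, Finset.sum_add_distrib, ← Finset.mul_sum, h2, Finset.sum_ite_eq',
      Finset.mem_univ, if_true]
    rw [hμ, hQ]; ring
  have hNadd : ∀ i (t : ℝ), ∑ k, (v + t • Pi.single i 1 : ι → ℝ) k ^ 2 =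
      1 + 2 * t * v i + t ^ 2 := by
    intro i t
    have h3 : ∀ k, (v + t • Pi.single i 1 : ι → ℝ) k ^ 2 =
        v k ^ 2 + (if k = i then 2 * t * v k + t ^ 2 else 0) := by
      intro k
      simp only [Pi.add_apply, Pi.smul_apply, Pi.single_apply, smul_eq_mul]
      split_ifs <;> ring
    simp only [h3, Finset.sum_add_distrib, hv1, Finset.sum_ite_eq', Finset.mem_univ, if_true]
    ring
  have hBle : ∀ i, B i ≤ μ * v i := by
    intro i
    by_contra! hlt
    set d := B i - μ * v i with hd
    have hd0 : 0 < d := by linarith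
    set t := d / (|μ| + 1) with ht
    have ht0 : 0 < t := by positivity
    have htd : t * (|μ| + 1) = d := by rw [ht]; field_simp
    have h := hμw (v + t • Pi.single i 1) (fun k => by
        have : 0 ≤ (Pi.single i 1 : ι → ℝ) k := by
          rw [Pi.single_apply]; split_ifs <;> norm_num
        exact add_nonneg (hv0 k) (mul_nonneg ht0.le this)) (by
        rw [hNadd]
        have := mul_nonneg ht0.le (hv0 i)
        nlinarith [sq_nonneg t])
    rw [hQadd, hNadd] at h
    have h1 := hA0 i i
    have h2 := le_abs_self μ
    have h3 : 2 * t * d ≤ t ^ 2 * |μ| := by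
      nlinarith [mul_nonneg (sq_nonneg t) h1, mul_le_mul_of_nonneg_left h2 (sq_nonneg t)]
    have h4 : t * (t * (|μ| + 1)) = t * d := by rw [htd]
    nlinarith [mul_pos ht0 hd0, sq_nonneg t]
  have hzero : ∀ i, v i * (μ * v i - B i) = 0 := by
    have hs : ∑ i, v i * (μ * v i - B i) = 0 := by
      have : ∀ i, v i * (μ * v i - B i) = μ * v i ^ 2 - v i * B i := fun i => by ring
      simp only [this, Finset.sum_sub_distrib, ← Finset.mul_sum, hv1]
      rw [hμ, hQ]; ring
    intro i
    exact (Finset.sum_eq_zero_iff_of_nonneg fun i _ =>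
      mul_nonneg (hv0 i) (sub_nonneg.2 (hBle i))).1 hs i (Finset.mem_univ i)
  refine ⟨v, hv0, ?_, fun i => ?_⟩
  · by_contra! h
    have : ∀ i, v i = 0 := fun i => le_antisymm (h i) (hv0 i)
    simp [this] at hv1
  · rcases mul_eq_zero.1 (hzero i) with h | h
    · rw [h, mul_zero]
      exact Finset.sum_nonneg fun j _ => mul_nonneg (hA0 i j) (hv0 j)
    · have := mul_le_mul_of_nonneg_right hcμ (hv0 i)
      change c * v i ≤ B i
      linarith

/-- A Følner set carries a nonnegative function which is almost superharmonic on it. -/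
lemma exists_subharmonic_of_folner {Γ : Type*} [Group Γ] [DecidableEq Γ] {S F : Finset Γ}
    (hsymm : ∀ s ∈ S, s⁻¹ ∈ S) (hF : F.Nonempty) {ε : ℝ}
    (hfol : ∀ g ∈ S, (((F.image fun x => g * x) ∆ F).card : ℝ) ≤ ε * F.card) :
    ∃ f : Γ → ℝ, (∀ x, 0 ≤ f x) ∧ (∀ x ∉ F, f x = 0) ∧ (∃ x, 0 < f x) ∧
      ∀ x ∈ F, (1 - ε) * S.card * f x ≤ ∑ s ∈ S, f (s * x) := by
  have : Nonempty F := hF.to_subtype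
  obtain ⟨v, hv0, ⟨i, hi⟩, hv⟩ := exists_nonneg_le_mulVec (ι := F)
    (fun i j => ∑ s ∈ S, if s * (i : Γ) = j then (1 : ℝ) else 0)
    (fun i j => Finset.sum_nonneg fun s _ => by split_ifs <;> norm_num)
    (fun i j => by
      refine Finset.sum_nbij' (·⁻¹) (·⁻¹) hsymm hsymm (by simp) (by simp) fun s _ => ?_
      congr 1
      rw [inv_mul_eq_iff_eq_mul]
      exact propext eq_comm)
    (c := (1 - ε) * S.card) (by
      have h1 : ∀ s ∈ S, (1 - ε) * F.card ≤
          ∑ i : F, ∑ j : F, if s * (i : Γ) = j then (1 : ℝ) else 0 := by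
        intro s hs
        have h2 : ∀ i : F, (∑ j : F, if s * (i : Γ) = j then (1 : ℝ) else 0) =
            if s * (i : Γ) ∈ F then 1 else 0 := by
          intro i
          rw [Finset.sum_coe_sort F fun j => if s * (i : Γ) = j then (1 : ℝ) else 0]
          simp
        simp only [h2]
        rw [Finset.sum_coe_sort F fun i => if s * i ∈ F then (1 : ℝ) else 0, Finset.sum_boole]
        have h3 : F.card ≤ (F.filter fun x => s * x ∈ F).card +
            ((F.image fun x => s * x) ∆ F).card := by
          rw [← Finset.card_filter_add_card_filter_not (s := F) fun x => s * x ∈ F]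
          refine Nat.add_le_add_left ?_ _
          rw [← Finset.card_image_of_injective (F.filter fun x => ¬ s * x ∈ F)
            (mul_right_injective s)]
          refine Finset.card_le_card fun y hy => ?_
          simp only [Finset.mem_image, Finset.mem_filter] at hy
          obtain ⟨x, ⟨hx, hsx⟩, rfl⟩ := hy
          exact Finset.mem_symmDiff.2 (Or.inl ⟨Finset.mem_image_of_mem _ hx, hsx⟩)
        have h4 := hfol s hs
        have h5 : (F.card : ℝ) ≤ (F.filter fun x => s * x ∈ F).card +
            ((F.image fun x => s * x) ∆ F).card := by exact_mod_cast h3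
        linarith
      have h2 := Finset.sum_le_sum h1
      rw [Finset.sum_const, nsmul_eq_mul] at h2
      rw [Fintype.card_coe]
      calc _ = (S.card : ℝ) * ((1 - ε) * F.card) := by ring
        _ ≤ _ := h2
        _ = _ := by
          rw [Finset.sum_comm]
          exact Finset.sum_congr rfl fun i _ => Finset.sum_comm)
  set f : Γ → ℝ := fun x => if h : x ∈ F then v ⟨x, h⟩ else 0 with hf
  have hfv : ∀ i : F, f i = v i := fun i => by simp [hf]
  refine ⟨f, fun x => ?_, fun x hx => dif_neg hx, ⟨i, by rwa [hfv]⟩, fun x hx => ?_⟩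
  · simp only [hf]; split_ifs
    exacts [hv0 _, le_rfl]
  · have h := hv ⟨x, hx⟩
    rw [← hfv] at h
    refine h.trans_eq ?_
    simp only [Finset.sum_mul]
    rw [Finset.sum_comm]
    refine Finset.sum_congr rfl fun s _ => ?_
    simp only [← hfv]
    rw [Finset.sum_coe_sort F fun j => (if s * x = j then (1 : ℝ) else 0) * f j]
    simp only [ite_mul, one_mul, zero_mul, Finset.sum_ite_eq]
    split_ifs with hsx
    exacts [rfl, (dif_neg hsx : f (s * x) = 0).symm]

/-- The killed branching random walk with parent of the root at `x`, in which particles are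
removed when they leave `F`, is extinct before generation `n`. -/
def killedExtinct {Γ : Type*} [Group Γ] (F : Finset Γ) : ℕ → Γ → Set (List ℕ → ℕ × Γ)
  | 0, _ => ∅
  | n + 1, x => {ω | x * (ω []).2 ∈ F →
      ∀ i < (ω []).1, subtree i ω ∈ killedExtinct F n (x * (ω []).2)}

lemma killedExtinct_succ_eq {Γ : Type*} [Group Γ] [DecidableEq Γ] (F : Finset Γ) (n : ℕ)
    (x : Γ) : killedExtinct F (n + 1) x =
      {ω | ∀ i ∈ (if x * (ω []).2 ∈ F then Finset.range (ω []).1 else ∅),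
        subtree i ω ∈ killedExtinct F n (x * (ω []).2)} := by
  ext ω
  simp only [killedExtinct, Set.mem_ofPred_eq]
  split_ifs with h <;> simp [h]

lemma measurableSet_killedExtinct {Γ : Type*} [Group Γ] [DecidableEq Γ] [MeasurableSpace Γ]
    [MeasurableSingletonClass Γ] [Countable Γ] (F : Finset Γ) (n : ℕ) (x : Γ) :
    MeasurableSet (killedExtinct F n x) := by
  induction n generalizing x with
  | zero => exact MeasurableSet.empty
  | succ n ih =>
    rw [killedExtinct_succ_eq]
    exact measurableSet_subtrees
      (fun a : ℕ × Γ => if x * a.2 ∈ F then Finset.range a.1 else ∅)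
      (D := fun a => killedExtinct F n (x * a.2)) fun a => ih _

lemma monotone_killedExtinct {Γ : Type*} [Group Γ] (F : Finset Γ) (x : Γ) :
    Monotone fun n => killedExtinct F n x := by
  refine monotone_nat_of_le_succ fun n => ?_
  induction n generalizing x with
  | zero => exact Set.empty_subset _
  | succ n ih => exact fun ω hω hx i hi => ih _ (hω hx i hi)

lemma exists_alive_of_notMem_killedExtinct {Γ : Type*} [Group Γ] (F : Finset Γ) (n : ℕ) (x : Γ)
    (ω : List ℕ → ℕ × Γ) (h : ω ∉ killedExtinct F (n + 1) x) :
    ∃ v : List ℕ, v.length = n ∧ alive ω v ∧ x * (ω []).2 * posG ω v ∈ F := by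
  induction n generalizing x ω with
  | zero =>
    refine ⟨[], rfl, trivial, ?_⟩
    by_contra hx
    exact h fun hx' => absurd (by simpa [posG] using hx') hx
  | succ n ih =>
    rw [killedExtinct, Set.mem_ofPred_eq] at h
    push Not at h
    obtain ⟨-, i, hi, hω⟩ := h
    obtain ⟨v, hv, hal, hpos⟩ := ih _ _ hω
    refine ⟨v ++ [i], by simp [hv], (alive_append_singleton ω v i).2 ⟨hi, hal⟩, ?_⟩
    rwa [posG_append_singleton, ← mul_assoc]

lemma ofReal_one_sub_average {Γ : Type*} {S : Finset Γ} (hS : S.Nonempty) (g : Γ → ℝ)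
    (hg : ∀ s, g s ≤ 1) :
    (S.card : ℝ≥0∞)⁻¹ * ∑ s ∈ S, ENNReal.ofReal (1 - g s) =
      ENNReal.ofReal (1 - (S.card : ℝ)⁻¹ * ∑ s ∈ S, g s) := by
  have hc : (0 : ℝ) < S.card := by exact_mod_cast hS.card_pos
  rw [← ENNReal.ofReal_sum_of_nonneg fun s _ => sub_nonneg.2 (hg s), ← ENNReal.ofReal_natCast,
    ← ENNReal.ofReal_inv_of_pos hc, ← ENNReal.ofReal_mul (inv_nonneg.2 hc.le)]
  congr 1
  rw [Finset.sum_sub_distrib, mul_sub]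
  simp [hc.ne']

/-- A supersolution of the killed generating-function recursion bounds the extinction
probabilities. -/
lemma measure_killedExtinct_le {Γ : Type*} [Group Γ] [DecidableEq Γ] [MeasurableSpace Γ]
    [MeasurableSingletonClass Γ] [Countable Γ] {S F : Finset Γ} (hS : S.Nonempty) (p : PMF ℕ)
    {g : Γ → ℝ} (hg1 : ∀ x, g x ≤ 1) (hgF : ∀ x ∉ F, g x = 0)
    (hg : ∀ x ∈ F, ∑' k : ℕ, p k *
      ENNReal.ofReal (1 - (S.card : ℝ)⁻¹ * ∑ s ∈ S, g (x * s)) ^ k ≤ ENNReal.ofReal (1 - g x))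
    (n : ℕ) (x : Γ) :
    (Measure.infinitePi fun _ : List ℕ => p.toMeasure.prod (unifS S)) (killedExtinct F n x) ≤
      ENNReal.ofReal (1 - (S.card : ℝ)⁻¹ * ∑ s ∈ S, g (x * s)) := by
  have := isProbabilityMeasure_unifS hS
  induction n generalizing x with
  | zero => simp [killedExtinct]
  | succ n ih =>
    rw [killedExtinct_succ_eq, measure_subtrees_eq_lintegral
      (p.toMeasure.prod (unifS S)) (fun a : ℕ × Γ => if x * a.2 ∈ F then Finset.range a.1 else ∅)
      (D := fun a => killedExtinct F n (x * a.2)) fun a => measurableSet_killedExtinct _ _ _,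
      lintegral_offspring_unifS p hS, ← ofReal_one_sub_average hS (fun s => g (x * s))
        fun s => hg1 _]
    gcongr with s hs
    dsimp only
    by_cases hx : x * s ∈ F
    · simp only [hx, if_true, Finset.card_range]
      exact (ENNReal.tsum_le_tsum fun k => by gcongr; exact ih _).trans (hg _ hx)
    · simp [hx, p.tsum_coe, hgF]

lemma brwRecurrent_of_isAmenableGrp {Γ : Type*} [Group Γ] [DecidableEq Γ] [MeasurableSpace Γ]
    [MeasurableSingletonClass Γ] [Countable Γ] (hΓ : IsAmenableGrp Γ) {S : Finset Γ}
    (hS : S.Nonempty) (hsymm : ∀ s ∈ S, s⁻¹ ∈ S) (p : PMF ℕ)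
    (hm : 1 < ∑' k : ℕ, (k : ℝ≥0∞) * p k) :
    BRWRecurrent (Measure.infinitePi fun _ : List ℕ => p.toMeasure.prod (unifS S)) := by
  have := isProbabilityMeasure_unifS hS
  set π := Measure.infinitePi fun _ : List ℕ => p.toMeasure.prod (unifS S) with hπ
  have hc : (0 : ℝ) < S.card := by exact_mod_cast hS.card_pos
  obtain ⟨m, t₀, hm1, ht₀, ht₁, hpgf⟩ := exists_generating_function_le p hm
  have hm0 : 0 < m := one_pos.trans hm1
  obtain ⟨F, hF, hfol⟩ := hΓ S (1 - m⁻¹) (sub_pos.2 (inv_lt_one_of_one_lt₀ hm1))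
  obtain ⟨f, hf0, hfF, ⟨x₀, hx₀⟩, hf⟩ := exists_subharmonic_of_folner hsymm hF hfol
  simp only [sub_sub_cancel] at hf
  obtain ⟨H, hH0, hH⟩ : ∃ H, 0 < H ∧ ∀ x, f x ≤ H := by
    refine ⟨∑ x ∈ F, f x + 1, add_pos_of_nonneg_of_pos (Finset.sum_nonneg fun x _ => hf0 x)
      one_pos, fun x => ?_⟩
    by_cases hx : x ∈ F
    · linarith [Finset.single_le_sum (f := f) (fun x _ => hf0 x) hx]
    · rw [hfF x hx]
      linarith [Finset.sum_nonneg fun x (_ : x ∈ F) => hf0 x]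
  set δ := t₀ / H with hδ
  have hδ0 : 0 < δ := by positivity
  set g : Γ → ℝ := fun x => δ * f x⁻¹ with hg
  have hg0 : ∀ x, 0 ≤ g x := fun x => mul_nonneg hδ0.le (hf0 _)
  have hgt : ∀ x, g x ≤ t₀ := fun x =>
    (mul_le_mul_of_nonneg_left (hH _) hδ0.le).trans_eq (by rw [hδ]; field_simp)
  have hgS : ∀ x, ∑ s ∈ S, g (x * s) = δ * ∑ s ∈ S, f (s * x⁻¹) := by
    intro x
    rw [Finset.mul_sum]
    exact Finset.sum_nbij' (·⁻¹) (·⁻¹) hsymm hsymm (by simp) (by simp) fun s _ => by simp [hg]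
  have hbound := measure_killedExtinct_le (S := S) (F := F.image (·⁻¹)) hS p (g := g)
    (fun x => (hgt x).trans ht₁) (fun x hx => by
      have : x⁻¹ ∉ F := fun h => hx (Finset.mem_image.2 ⟨_, h, inv_inv x⟩)
      simp [hg, hfF _ this])
    (fun x hx => by
      have hx' : x⁻¹ ∈ F := by
        obtain ⟨y, hy, rfl⟩ := Finset.mem_image.1 hx
        rwa [inv_inv]
      refine (hpgf _ (mul_nonneg (inv_nonneg.2 hc.le) (Finset.sum_nonneg fun s _ => hg0 _))
        ?_).trans (ENNReal.ofReal_le_ofReal ?_)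
      · rw [inv_mul_le_iff₀ hc]
        exact (Finset.sum_le_card_nsmul _ _ _ fun s _ => hgt (x * s)).trans_eq (nsmul_eq_mul _ _)
      · have h := mul_le_mul_of_nonneg_left (hf _ hx') (mul_nonneg hm0.le hδ0.le)
        have h' : m * δ * (m⁻¹ * S.card * f x⁻¹) = S.card * g x := by
          simp only [hg]; field_simp
        rw [h'] at h
        rw [hgS, sub_le_sub_iff_left, ← mul_assoc, mul_comm m, mul_assoc, ← div_eq_inv_mul,
          le_div_iff₀ hc]
        linarith)
  obtain ⟨s₀, hs₀⟩ := hS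
  set x := x₀⁻¹ * s₀⁻¹ with hx
  have hpos : 0 < (S.card : ℝ)⁻¹ * ∑ s ∈ S, g (x * s) := by
    refine mul_pos (inv_pos.2 hc) (Finset.sum_pos' (fun s _ => hg0 _) ⟨s₀, hs₀, ?_⟩)
    simpa [hx, hg] using mul_pos hδ0 hx₀
  have hlt : π (⋃ n, killedExtinct (F.image (·⁻¹)) n x) < 1 := by
    rw [(monotone_killedExtinct _ x).measure_iUnion]
    refine (iSup_le fun n => hbound n x).trans_lt ?_
    rw [ENNReal.ofReal_lt_one]
    linarith
  have hcompl : 0 < π (⋃ n, killedExtinct (F.image (·⁻¹)) n x)ᶜ := by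
    rw [prob_compl_eq_one_sub (MeasurableSet.iUnion fun n => measurableSet_killedExtinct _ n x)]
    exact tsub_pos_of_lt hlt
  refine hcompl.trans_le (measure_mono fun ω hω => ?_)
  have hω' : ∀ n, ω ∉ killedExtinct (F.image (·⁻¹)) (n + 1) x := fun n h =>
    hω (Set.mem_iUnion.2 ⟨_, h⟩)
  choose v hvl hva hvp using fun n => exists_alive_of_notMem_killedExtinct _ n x ω (hω' n)
  have hinj : Function.Injective v := fun a b hab => by rw [← hvl a, ← hvl b, hab]
  obtain ⟨y, hy⟩ := Finite.exists_infinite_fiber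
    fun n => (⟨_, hvp n⟩ : (F.image (·⁻¹) : Finset Γ))
  refine ⟨(x * (ω []).2)⁻¹ * y, ?_⟩
  refine ((Set.infinite_coe_iff.1 hy).image hinj.injOn).mono ?_
  rintro _ ⟨n, hn, rfl⟩
  refine ⟨hva n, ?_⟩
  have : x * (ω []).2 * posG ω (v n) = y := congrArg Subtype.val hn
  rw [← this, inv_mul_cancel_left]

open scoped Pointwise in
lemma exists_card_symmDiff_le {Γ : Type*} [Group Γ] [DecidableEq Γ] {S : Finset Γ}
    (hgen : Subgroup.closure (S : Set Γ) = ⊤) (g : Γ) :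
    ∃ C : ℕ, ∀ F : Finset Γ, ((g • F) ∆ F).card ≤ C * ∑ s ∈ S, ((s • F) ∆ F).card := by
  have hg : g ∈ Subgroup.closure (S : Set Γ) := hgen ▸ Subgroup.mem_top g
  induction hg using Subgroup.closure_induction with
  | mem s hs =>
    refine ⟨1, fun F => ?_⟩
    rw [one_mul]
    exact Finset.single_le_sum (f := fun s => ((s • F) ∆ F).card) (fun _ _ => Nat.zero_le _) hs
  | one => exact ⟨0, fun F => by simp⟩
  | mul a b _ _ ha hb =>
    obtain ⟨Ca, ha⟩ := ha
    obtain ⟨Cb, hb⟩ := hb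
    refine ⟨Cb + Ca, fun F => ?_⟩
    have h : ((a * b) • F) ∆ F ⊆ (a • ((b • F) ∆ F)) ∪ ((a • F) ∆ F) := by
      rw [Finset.smul_finset_symmDiff, mul_smul]
      exact symmDiff_triangle _ _ _
    calc _ ≤ _ := (Finset.card_le_card h).trans (Finset.card_union_le _ _)
      _ ≤ _ := by
        rw [Finset.card_smul_finset, add_mul]
        exact add_le_add (hb F) (ha F)
  | inv a _ ha =>
    obtain ⟨C, h⟩ := ha
    refine ⟨C, fun F => ?_⟩
    have : (a⁻¹ • F) ∆ F = a⁻¹ • ((a • F) ∆ F) := by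
      rw [Finset.smul_finset_symmDiff, inv_smul_smul, symmDiff_comm]
    rw [this, Finset.card_smul_finset]
    exact h F

lemma tsum_abs_indicator_sub {Γ : Type*} [Group Γ] [DecidableEq Γ] (F : Finset Γ) (g : Γ) :
    ∑' x, |(F : Set Γ).indicator (1 : Γ → ℝ) (g⁻¹ * x) - (F : Set Γ).indicator (1 : Γ → ℝ) x| =
      ((F.image fun x => g * x) ∆ F).card := by
  have h : ∀ x, |(F : Set Γ).indicator (1 : Γ → ℝ) (g⁻¹ * x) -
      (F : Set Γ).indicator (1 : Γ → ℝ) x| =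
        if x ∈ (F.image fun x => g * x) ∆ F then 1 else 0 := by
    intro x
    have : x ∈ F.image (fun x => g * x) ↔ g⁻¹ * x ∈ F := by
      simp only [Finset.mem_image]
      constructor
      · rintro ⟨y, hy, rfl⟩; simpa using hy
      · exact fun hx => ⟨_, hx, by simp⟩
    simp only [Finset.mem_symmDiff, this, Set.indicator_apply, Finset.mem_coe, Pi.one_apply]
    by_cases h₁ : g⁻¹ * x ∈ F <;> by_cases h₂ : x ∈ F <;> simp [h₁, h₂]
  simp only [h]
  rw [tsum_eq_sum (s := (F.image fun x => g * x) ∆ F) fun x hx => if_neg hx,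
    Finset.sum_ite_mem, Finset.inter_self]
  simp

/-- A group which is not amenable satisfies a linear isoperimetric inequality with respect to
every finite symmetric generating set. -/
lemma exists_isoperimetric {Γ : Type*} [Group Γ] [DecidableEq Γ] (hΓ : ¬ IsAmenableGrp Γ)
    {S : Finset Γ} (hsymm : ∀ s ∈ S, s⁻¹ ∈ S) (hgen : Subgroup.closure (S : Set Γ) = ⊤) :
    ∃ κ : ℝ, 0 < κ ∧ ∀ F : Finset Γ, κ * F.card ≤ ∑ s ∈ S,
      ∑' x, |(F : Set Γ).indicator (1 : Γ → ℝ) (s * x) -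
        (F : Set Γ).indicator (1 : Γ → ℝ) x| := by
  unfold IsAmenableGrp at hΓ
  push Not at hΓ
  obtain ⟨T, ε, hε, hT⟩ := hΓ
  choose C hC using exists_card_symmDiff_le hgen
  set K : ℝ := ∑ g ∈ T, (C g : ℝ) + 1 with hK
  have hK0 : 0 < K := by positivity
  refine ⟨ε / K, by positivity, fun F => ?_⟩
  have hsum : ∑ s ∈ S, ∑' x, |(F : Set Γ).indicator (1 : Γ → ℝ) (s * x) -
      (F : Set Γ).indicator (1 : Γ → ℝ) x| =
        ∑ s ∈ S, (((F.image fun x => s * x) ∆ F).card : ℝ) := by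
    refine Finset.sum_nbij' (·⁻¹) (·⁻¹) hsymm hsymm (by simp) (by simp) fun s _ => ?_
    rw [← tsum_abs_indicator_sub, inv_inv]
  rw [hsum]
  set E := ∑ s ∈ S, (((F.image fun x => s * x) ∆ F).card : ℝ) with hE
  have hE0 : 0 ≤ E := Finset.sum_nonneg fun _ _ => Nat.cast_nonneg _
  rcases F.eq_empty_or_nonempty with rfl | hF
  · simpa using hE0
  obtain ⟨g, hg, hlt⟩ := hT F hF
  have h₁ : (((F.image fun x => g * x) ∆ F).card : ℝ) ≤ C g * E := by
    rw [hE]; exact_mod_cast hC g F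
  have h₂ : (C g : ℝ) ≤ K := by
    have := Finset.single_le_sum (f := fun g => (C g : ℝ)) (fun _ _ => Nat.cast_nonneg _) hg
    linarith
  rw [div_mul_eq_mul_div, div_le_iff₀ hK0]
  nlinarith [mul_le_mul_of_nonneg_right h₂ hE0]

lemma Function.HasFiniteSupport.comp_mul_left {Γ : Type*} [Group Γ] {f : Γ → ℝ}
    (hf : f.HasFiniteSupport) (s : Γ) : (fun x => f (s * x)).HasFiniteSupport :=
  hf.fun_comp_of_injective (mul_right_injective s)

lemma Function.HasFiniteSupport.abs {α : Type*} {f : α → ℝ} (hf : f.HasFiniteSupport) :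
    (fun x => |f x|).HasFiniteSupport :=
  hf.fun_comp (g := fun x : ℝ => |x|) abs_zero

lemma Function.HasFiniteSupport.sq {α : Type*} {f : α → ℝ} (hf : f.HasFiniteSupport) :
    (fun x => f x ^ 2).HasFiniteSupport :=
  hf.fun_comp (g := fun x : ℝ => x ^ 2) (zero_pow two_ne_zero)

/-- The functional form of the isoperimetric inequality. -/
lemma isoperimetric_functional {Γ : Type*} [Group Γ] {S : Finset Γ} {κ : ℝ}
    (hκ : ∀ F : Finset Γ, κ * F.card ≤ ∑ s ∈ S,
      ∑' x, |(F : Set Γ).indicator (1 : Γ → ℝ) (s * x) - (F : Set Γ).indicator (1 : Γ → ℝ) x|)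
    {f : Γ → ℝ} (hf : f.HasFiniteSupport) (hf0 : ∀ x, 0 ≤ f x) :
    κ * ∑' x, f x ≤ ∑ s ∈ S, ∑' x, |f (s * x) - f x| := by
  obtain ⟨n, hn⟩ : ∃ n, hf.toFinset.card = n := ⟨_, rfl⟩
  induction n using Nat.strong_induction_on generalizing f with
  | _ n ih =>
    set V := hf.toFinset with hV
    have hmemV : ∀ x, x ∈ V ↔ f x ≠ 0 := fun x => Set.Finite.mem_toFinset hf
    rcases V.eq_empty_or_nonempty with hV0 | hV0
    · have : f = 0 := by
        ext x
        by_contra hx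
        simpa [hV0] using (hmemV x).2 hx
      simp [this]
    obtain ⟨x₀, hx₀, hmin⟩ := V.exists_min_image f hV0
    set χ : Γ → ℝ := (V : Set Γ).indicator 1 with hχ
    have hχ1 : ∀ x ∈ V, χ x = 1 := fun x hx => by simp [hχ, hx]
    have hχ0 : ∀ x ∉ V, χ x = 0 := fun x hx => by simp [hχ, hx]
    have hχf : χ.HasFiniteSupport := V.finite_toSet.subset (by
      intro x hx
      by_contra h
      exact hx (hχ0 x h))
    set c := f x₀ with hc
    have hc0 : 0 ≤ c := hf0 x₀
    set g : Γ → ℝ := fun x => f x - c * χ x with hg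
    have hfV : ∀ x ∉ V, f x = 0 := fun x hx => by simpa using (hmemV x).not.1 hx
    have hg0 : ∀ x, 0 ≤ g x := by
      intro x
      by_cases hx : x ∈ V
      · simpa [hg, hχ1 x hx] using hmin x hx
      · simp [hg, hχ0 x hx, hfV x hx]
    have hgV : ∀ x ∉ V, g x = 0 := fun x hx => by simp [hg, hχ0 x hx, hfV x hx]
    have hgf : g.HasFiniteSupport := by fun_prop
    have hlt : hgf.toFinset.card < n := by
      rw [← hn]
      refine Finset.card_lt_card ⟨fun x hx => ?_, fun h => ?_⟩
      · by_contra hxV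
        exact ((Set.Finite.mem_toFinset hgf).1 hx : g x ≠ 0) (hgV x hxV)
      · have : g x₀ ≠ 0 := (Set.Finite.mem_toFinset hgf).1 (h hx₀)
        exact this (by simp [hg, hχ1 x₀ hx₀, hc])
    have hsplit : ∀ x y, |f x - f y| = |g x - g y| + c * |χ x - χ y| := by
      intro x y
      have hfg : ∀ x, f x = g x + c * χ x := fun x => by simp [hg]
      rw [hfg x, hfg y]
      by_cases hx : x ∈ V <;> by_cases hy : y ∈ V
      · simp [hχ1 x hx, hχ1 y hy]
      · simp [hχ1 x hx, hχ0 y hy, hgV y hy, abs_of_nonneg (hg0 x),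
          abs_of_nonneg (add_nonneg (hg0 x) hc0)]
      · simp only [hχ0 x hx, hχ1 y hy, hgV x hx, mul_zero, add_zero, mul_one, zero_sub, abs_neg,
          abs_one, abs_of_nonneg (hg0 y), abs_of_nonneg (add_nonneg (hg0 y) hc0)]
      · simp [hχ0 x hx, hχ0 y hy]
    have h₁ := ih _ hlt hgf hg0 rfl
    have h₂ := mul_le_mul_of_nonneg_left (hκ V) hc0
    have h₃ : ∑' x, f x = ∑' x, g x + c * V.card := by
      have h4 : ∑' x, χ x = V.card := by
        rw [tsum_eq_sum (s := V) hχ0, Finset.sum_congr rfl hχ1]; simp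
      rw [← h4, ← tsum_mul_left, ← Summable.tsum_add (summable_of_hasFiniteSupport hgf)
        (summable_of_hasFiniteSupport (by fun_prop))]
      simp [hg]
    have h₄ : ∀ s, ∑' x, |f (s * x) - f x| =
        ∑' x, |g (s * x) - g x| + c * ∑' x, |χ (s * x) - χ x| := by
      intro s
      simp only [hsplit]
      rw [Summable.tsum_add, tsum_mul_left]
      · exact summable_of_hasFiniteSupport ((hgf.comp_mul_left s).fun_sub hgf).abs
      · exact (summable_of_hasFiniteSupport ((hχf.comp_mul_left s).fun_sub hχf).abs).mul_left c
    rw [h₃, Finset.sum_congr rfl fun s _ => h₄ s, Finset.sum_add_distrib, ← Finset.mul_sum]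
    linarith

/-- The isoperimetric inequality forces a spectral gap (Cheeger's inequality). -/
lemma exists_spectral_gap {Γ : Type*} [Group Γ] {S : Finset Γ} (hS : S.Nonempty) {κ : ℝ}
    (hκ0 : 0 < κ) (hκ : ∀ F : Finset Γ, κ * F.card ≤ ∑ s ∈ S,
      ∑' x, |(F : Set Γ).indicator (1 : Γ → ℝ) (s * x) - (F : Set Γ).indicator (1 : Γ → ℝ) x|) :
    ∃ l : ℝ, 0 ≤ l ∧ l < 1 ∧ ∀ f : Γ → ℝ, f.HasFiniteSupport → (∀ x, 0 ≤ f x) →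
      ∑ s ∈ S, ∑' x, f (s * x) * f x ≤ l * S.card * ∑' x, f x ^ 2 := by
  have hc : (0 : ℝ) < S.card := by exact_mod_cast hS.card_pos
  set d : ℝ := ((S.card : ℕ) : ℝ) with hd
  refine ⟨max 0 (1 - κ ^ 2 / (8 * d ^ 2)), le_max_left _ _, ?_, fun f hf hf0 => ?_⟩
  · have : 0 < κ ^ 2 / (8 * d ^ 2) := by positivity
    exact max_lt one_pos (by linarith)
  set N := ∑' x, f x ^ 2 with hN
  have hN0 : 0 ≤ N := tsum_nonneg fun x => sq_nonneg _
  have hf2 : (fun x => f x ^ 2).HasFiniteSupport := hf.sq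
  set θ := κ / (4 * d) with hθ
  have hθ0 : 0 < θ := by positivity
  have hs : ∀ s ∈ S, ∑' x, |f (s * x) ^ 2 - f x ^ 2| ≤
      (1 / θ + 2 * θ) * N - 1 / θ * ∑' x, f (s * x) * f x := by
    intro s _
    have hfs := hf.comp_mul_left s
    have hfs2 : (fun x => f (s * x) ^ 2).HasFiniteSupport := hfs.sq
    have hNs : ∑' x, f (s * x) ^ 2 = N := (Equiv.mulLeft s).tsum_eq fun x => f x ^ 2
    have hprod : (fun x => f (s * x) * f x).HasFiniteSupport := hfs.fun_mul_left f
    have heq : (1 / θ + 2 * θ) * N - 1 / θ * ∑' x, f (s * x) * f x =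
        ∑' x, ((1 / (2 * θ) + θ) * (f (s * x) ^ 2 + f x ^ 2) - 1 / θ * (f (s * x) * f x)) := by
      have hsa : Summable fun x => f (s * x) ^ 2 := summable_of_hasFiniteSupport hfs2
      have hsb : Summable fun x => f x ^ 2 := summable_of_hasFiniteSupport hf2
      rw [Summable.tsum_sub ((hsa.add hsb).mul_left _)
        ((summable_of_hasFiniteSupport hprod).mul_left _), tsum_mul_left, tsum_mul_left,
        hsa.tsum_add hsb, hNs]
      field_simp; ring
    rw [heq]
    refine Summable.tsum_le_tsum (fun x => ?_)
      (summable_of_hasFiniteSupport (hfs2.fun_sub hf2).abs)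
      ((((summable_of_hasFiniteSupport hfs2).add (summable_of_hasFiniteSupport hf2)).mul_left
        _).sub ((summable_of_hasFiniteSupport hprod).mul_left _))
    generalize f (s * x) = a
    generalize f x = b
    have hfac : (1 / (2 * θ) + θ) * (a ^ 2 + b ^ 2) - 1 / θ * (a * b) =
        ((a - b) ^ 2 + 2 * θ ^ 2 * (a ^ 2 + b ^ 2)) / (2 * θ) := by
      field_simp; ring
    rw [hfac, le_div_iff₀ (by positivity)]
    rcases abs_cases (a ^ 2 - b ^ 2) with ⟨h, -⟩ | ⟨h, -⟩ <;> rw [h]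
    · nlinarith [sq_nonneg (a - b - θ * (a + b)), mul_nonneg (sq_nonneg θ) (sq_nonneg (a - b))]
    · nlinarith [sq_nonneg (a - b + θ * (a + b)), mul_nonneg (sq_nonneg θ) (sq_nonneg (a - b))]
  have h := (isoperimetric_functional hκ hf2 fun x => sq_nonneg _).trans (Finset.sum_le_sum hs)
  rw [Finset.sum_sub_distrib, Finset.sum_const, nsmul_eq_mul, ← Finset.mul_sum, ← hd] at h
  set B := ∑ s ∈ S, ∑' x, f (s * x) * f x with hB
  have h' : B ≤ (1 - κ ^ 2 / (8 * d ^ 2)) * d * N := by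
    have h₁ := mul_le_mul_of_nonneg_left h hθ0.le
    have h₂ : θ * (d * ((1 / θ + 2 * θ) * N) - 1 / θ * B) = d * (1 + 2 * θ ^ 2) * N - B := by
      field_simp
    have h₃ : (1 - κ ^ 2 / (8 * d ^ 2)) * d * N = d * (1 + 2 * θ ^ 2) * N - θ * (κ * N) := by
      rw [hθ]; field_simp; ring
    rw [h₂] at h₁
    linarith
  exact h'.trans (by gcongr; exact le_max_right _ _)

/-- The averaging operator of the simple random walk by left multiplication. -/
noncomputable def leftAverage {Γ : Type*} [Group Γ] (S : Finset Γ) (f : Γ → ℝ) (x : Γ) : ℝ :=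
  (S.card : ℝ)⁻¹ * ∑ s ∈ S, f (s * x)

lemma leftAverage_nonneg {Γ : Type*} [Group Γ] (S : Finset Γ) {f : Γ → ℝ} (hf : ∀ x, 0 ≤ f x)
    (x : Γ) : 0 ≤ leftAverage S f x :=
  mul_nonneg (by positivity) (Finset.sum_nonneg fun _ _ => hf _)

lemma hasFiniteSupport_leftAverage {Γ : Type*} [Group Γ] (S : Finset Γ) {f : Γ → ℝ}
    (hf : f.HasFiniteSupport) : (leftAverage S f).HasFiniteSupport := by
  have h : (⋃ s ∈ S, Function.support fun x => f (s * x)).Finite :=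
    S.finite_toSet.biUnion fun s _ => hf.comp_mul_left s
  refine h.subset fun x hx => ?_
  by_contra hx'
  simp only [Set.mem_iUnion, Function.mem_support, not_exists, not_not] at hx'
  refine hx ?_
  rw [leftAverage, Finset.sum_eq_zero hx', mul_zero]

lemma tsum_leftAverage_sq_le {Γ : Type*} [Group Γ] {S : Finset Γ} (hS : S.Nonempty)
    (hsymm : ∀ s ∈ S, s⁻¹ ∈ S) {l : ℝ}
    (hl : ∀ f : Γ → ℝ, f.HasFiniteSupport → (∀ x, 0 ≤ f x) →
      ∑ s ∈ S, ∑' x, f (s * x) * f x ≤ l * S.card * ∑' x, f x ^ 2)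
    {f : Γ → ℝ} (hf : f.HasFiniteSupport) (hf0 : ∀ x, 0 ≤ f x) :
    (2 - l) * ∑' x, leftAverage S f x ^ 2 ≤ l * ∑' x, f x ^ 2 := by
  have hc : (0 : ℝ) < S.card := by exact_mod_cast hS.card_pos
  set u := leftAverage S f with hu
  have huf : u.HasFiniteSupport := hasFiniteSupport_leftAverage S hf
  have hu0 : ∀ x, 0 ≤ u x := leftAverage_nonneg S hf0
  have hmix : ∀ {a b : Γ → ℝ}, b.HasFiniteSupport → ∀ s : Γ,
      Summable fun x => a (s * x) * b x := fun {a b} hb s =>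
    summable_of_hasFiniteSupport (hb.fun_mul_right (fun x => a (s * x)))
  set B := ∑ s ∈ S, ∑' x, f (s * x) * u x with hB
  have hBu : B = S.card * ∑' x, u x ^ 2 := by
    rw [hB, ← Summable.tsum_finsetSum fun s _ => hmix huf s, ← tsum_mul_left]
    refine tsum_congr fun x => ?_
    rw [← Finset.sum_mul, sq, ← mul_assoc]
    congr 1
    rw [hu, leftAverage, mul_inv_cancel_left₀ hc.ne']
  have hB' : ∑ s ∈ S, ∑' x, u (s * x) * f x = B := by
    refine Finset.sum_nbij' (·⁻¹) (·⁻¹) hsymm hsymm (by simp) (by simp) fun s _ => ?_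
    rw [← (Equiv.mulLeft s).tsum_eq fun x => f (s⁻¹ * x) * u x]
    simp [mul_comm]
  have hp := hl (fun x => f x + u x) (by fun_prop) fun x => add_nonneg (hf0 x) (hu0 x)
  have hfu : (fun x => f x - u x).HasFiniteSupport := by fun_prop
  have hm := hl (fun x => |f x - u x|) hfu.abs fun x => abs_nonneg _
  have hsq : ∑' x, (f x + u x) ^ 2 + ∑' x, |f x - u x| ^ 2 =
      2 * ∑' x, f x ^ 2 + 2 * ∑' x, u x ^ 2 := by
    have hsf : Summable fun x => f x ^ 2 := summable_of_hasFiniteSupport hf.sq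
    have hsu : Summable fun x => u x ^ 2 := summable_of_hasFiniteSupport huf.sq
    rw [← tsum_mul_left, ← tsum_mul_left, ← Summable.tsum_add (hsf.mul_left _) (hsu.mul_left _),
      ← Summable.tsum_add]
    · refine tsum_congr fun x => ?_
      rw [sq_abs]; ring
    · exact summable_of_hasFiniteSupport ((hf.fun_add huf).sq)
    · exact summable_of_hasFiniteSupport (hfu.abs.sq)
  have hle : 2 * B + 2 * B ≤ ∑ s ∈ S, ∑' x, (f (s * x) + u (s * x)) * (f x + u x) +
      ∑ s ∈ S, ∑' x, |f (s * x) - u (s * x)| * |f x - u x| := by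
    nth_rewrite 2 [← hB']
    rw [hB, Finset.mul_sum, Finset.mul_sum, ← Finset.sum_add_distrib, ← Finset.sum_add_distrib]
    refine Finset.sum_le_sum fun s _ => ?_
    have h₁ := (hmix (a := f) huf s).mul_left 2
    have h₂ := (hmix (a := u) hf s).mul_left 2
    have h₃ := hmix (a := fun x => f x + u x) (b := fun x => f x + u x) (by fun_prop) s
    have h₄ := hmix (a := fun x => |f x - u x|) (b := fun x => |f x - u x|) hfu.abs s
    rw [← tsum_mul_left, ← tsum_mul_left, ← h₁.tsum_add h₂, ← h₃.tsum_add h₄]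
    refine (h₁.add h₂).tsum_le_tsum (fun x => ?_) (h₃.add h₄)
    have := neg_abs_le ((f (s * x) - u (s * x)) * (f x - u x))
    rw [abs_mul] at this
    linarith
  have hpm := add_le_add hp hm
  rw [← mul_add, hsq] at hpm
  have h := hle.trans hpm
  rw [hBu] at h
  refine le_of_mul_le_mul_left ?_ hc
  linarith

/-- Exponential decay of the heat kernel on a group which is not amenable. -/
lemma exists_iterate_leftAverage_le {Γ : Type*} [Group Γ] [DecidableEq Γ]
    (hΓ : ¬ IsAmenableGrp Γ) {S : Finset Γ} (hS : S.Nonempty) (hsymm : ∀ s ∈ S, s⁻¹ ∈ S)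
    (hgen : Subgroup.closure (S : Set Γ) = ⊤) :
    ∃ q : ℝ, 0 ≤ q ∧ q < 1 ∧ ∀ (n : ℕ) (y x : Γ),
      (leftAverage S)^[n] (Pi.single y 1) x ≤ q ^ n := by
  obtain ⟨κ, hκ0, hκ⟩ := exists_isoperimetric hΓ hsymm hgen
  obtain ⟨l, hl0, hl1, hl⟩ := exists_spectral_gap hS hκ0 hκ
  set r := l / (2 - l) with hr
  have hr0 : 0 ≤ r := div_nonneg hl0 (by linarith)
  have hr1 : r < 1 := by rw [hr, div_lt_one (by linarith)]; linarith
  refine ⟨√r, Real.sqrt_nonneg _, (Real.sqrt_lt' one_pos).2 (by simpa using hr1), fun n y x => ?_⟩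
  set φ : ℕ → Γ → ℝ := fun n => (leftAverage S)^[n] (Pi.single y 1) with hφ
  have hφs : ∀ n, φ (n + 1) = leftAverage S (φ n) := fun n => Function.iterate_succ_apply' _ _ _
  have hmain : ∀ n, (φ n).HasFiniteSupport ∧ (∀ x, 0 ≤ φ n x) ∧ ∑' x, φ n x ^ 2 ≤ r ^ n := by
    intro n
    induction n with
    | zero =>
      refine ⟨(Set.finite_singleton y).subset Pi.support_single_subset, fun x => ?_, ?_⟩
      · simp only [hφ, Function.iterate_zero, id, Pi.single_apply]
        split_ifs <;> norm_num
      · simp only [hφ, Function.iterate_zero, id, Pi.single_apply, ite_pow]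
        simp
    | succ n ih =>
      obtain ⟨h₁, h₂, h₃⟩ := ih
      rw [hφs]
      refine ⟨hasFiniteSupport_leftAverage S h₁, leftAverage_nonneg S h₂, ?_⟩
      have h := tsum_leftAverage_sq_le hS hsymm hl h₁ h₂
      have h' : ∑' x, leftAverage S (φ n) x ^ 2 ≤ r * ∑' x, φ n x ^ 2 := by
        rw [hr, div_mul_eq_mul_div, le_div_iff₀ (by linarith)]
        linarith
      rw [pow_succ']
      exact h'.trans (mul_le_mul_of_nonneg_left h₃ hr0)
  obtain ⟨h₁, h₂, h₃⟩ := hmain n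
  have h₄ : φ n x ^ 2 ≤ r ^ n := le_trans
    ((summable_of_hasFiniteSupport (h₁.sq)).le_tsum x fun _ _ => sq_nonneg _) h₃
  refine (sq_le_sq₀ (h₂ x) (by positivity)).1 (h₄.trans_eq ?_)
  rw [← pow_mul, mul_comm, pow_mul, Real.sq_sqrt hr0]

/-- The event that, for the branching random walk started at `x` times the label of the root, the
particle with reversed address `u` is alive and sits at `y`. -/
def visitSet {Γ : Type*} [Group Γ] (u : List ℕ) (x y : Γ) : Set (List ℕ → ℕ × Γ) :=
  {ω | alive ω u.reverse ∧ x * (ω []).2 * posG ω u.reverse = y}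

lemma visitSet_cons {Γ : Type*} [Group Γ] (i : ℕ) (u : List ℕ) (x y : Γ) :
    visitSet (i :: u) x y =
      {ω | subtree i ω ∈ if i < (ω []).1 then visitSet u (x * (ω []).2) y else ∅} := by
  ext ω
  simp only [visitSet, List.reverse_cons, alive_append_singleton, posG_append_singleton,
    Set.mem_ofPred_eq, ← mul_assoc]
  split_ifs with h <;> simp [h]

lemma measurableSet_subtree {β : Type*} [MeasurableSpace β] [Countable β]
    [MeasurableSingletonClass β] (i : ℕ) {D : β → Set (List ℕ → β)}
    (hD : ∀ a, MeasurableSet (D a)) :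
    MeasurableSet {ω : List ℕ → β | subtree i ω ∈ D (ω [])} := by
  simpa using measurableSet_subtrees (fun _ => {i}) hD

lemma measure_subtree_mem {Γ : Type*} [MeasurableSpace Γ] [MeasurableSingletonClass Γ]
    [Countable Γ] (p : PMF ℕ) {S : Finset Γ} (hS : S.Nonempty) (i : ℕ)
    {D : ℕ × Γ → Set (List ℕ → ℕ × Γ)} (hD : ∀ a, MeasurableSet (D a)) :
    (Measure.infinitePi fun _ : List ℕ => p.toMeasure.prod (unifS S))
        {ω | subtree i ω ∈ D (ω [])} =
      (S.card : ℝ≥0∞)⁻¹ * ∑ s ∈ S, ∑' k, p k *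
        (Measure.infinitePi fun _ : List ℕ => p.toMeasure.prod (unifS S)) (D (k, s)) := by
  have := isProbabilityMeasure_unifS hS
  have h := measure_subtrees_eq_lintegral (p.toMeasure.prod (unifS S)) (fun _ => {i}) hD
  simp only [Finset.mem_singleton, forall_eq, Finset.card_singleton, pow_one] at h
  rw [h, lintegral_offspring_unifS p hS]

lemma measurableSet_visitSet {Γ : Type*} [Group Γ] [MeasurableSpace Γ]
    [MeasurableSingletonClass Γ] [Countable Γ] (u : List ℕ) (x y : Γ) :
    MeasurableSet (visitSet u x y) := by
  induction u generalizing x with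
  | nil =>
    have : visitSet [] x y = (fun ω : List ℕ → ℕ × Γ => ω []) ⁻¹' {a | x * a.2 = y} := by
      ext ω; simp [visitSet, alive, posG]
    rw [this]
    exact measurable_pi_apply _ (Set.to_countable _).measurableSet
  | cons i u ih =>
    rw [visitSet_cons]
    refine measurableSet_subtree i
      (D := fun a : ℕ × Γ => if i < a.1 then visitSet u (x * a.2) y else ∅) fun a => ?_
    split_ifs
    exacts [ih _, MeasurableSet.empty]

lemma ofReal_leftAverage_inv {Γ : Type*} [Group Γ] {S : Finset Γ} (hS : S.Nonempty)
    (hsymm : ∀ s ∈ S, s⁻¹ ∈ S) {f : Γ → ℝ} (hf : ∀ x, 0 ≤ f x) (x : Γ) :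
    ENNReal.ofReal (leftAverage S f x⁻¹) =
      (S.card : ℝ≥0∞)⁻¹ * ∑ s ∈ S, ENNReal.ofReal (f (x * s)⁻¹) := by
  have hc : (0 : ℝ) < S.card := by exact_mod_cast hS.card_pos
  rw [leftAverage, ENNReal.ofReal_mul (by positivity), ENNReal.ofReal_inv_of_pos hc,
    ENNReal.ofReal_natCast, ENNReal.ofReal_sum_of_nonneg fun _ _ => hf _]
  congr 1
  exact Finset.sum_nbij' (·⁻¹) (·⁻¹) hsymm hsymm (by simp) (by simp) fun s _ => by simp

lemma iterate_leftAverage_nonneg {Γ : Type*} [Group Γ] (S : Finset Γ) {f : Γ → ℝ}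
    (hf : ∀ x, 0 ≤ f x) (n : ℕ) : ∀ x, 0 ≤ (leftAverage S)^[n] f x := by
  induction n with
  | zero => exact hf
  | succ n ih =>
    rw [Function.iterate_succ_apply']
    exact leftAverage_nonneg S ih

/-- The many-to-one formula for a single particle. -/
lemma measure_visitSet {Γ : Type*} [Group Γ] [DecidableEq Γ] [MeasurableSpace Γ]
    [MeasurableSingletonClass Γ] [Countable Γ] (p : PMF ℕ) {S : Finset Γ} (hS : S.Nonempty)
    (hsymm : ∀ s ∈ S, s⁻¹ ∈ S) (u : List ℕ) (x y : Γ) :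
    (Measure.infinitePi fun _ : List ℕ => p.toMeasure.prod (unifS S)) (visitSet u x y) =
      (u.map fun i => ∑' k, if i < k then p k else 0).prod *
        ENNReal.ofReal ((leftAverage S)^[u.length + 1] (Pi.single y⁻¹ 1) x⁻¹) := by
  have := isProbabilityMeasure_unifS hS
  have h0 : ∀ z : Γ, (0 : ℝ) ≤ (Pi.single y⁻¹ 1 : Γ → ℝ) z := fun z => by
    rw [Pi.single_apply]; split_ifs <;> norm_num
  induction u generalizing x with
  | nil =>
    have : visitSet [] x y = {ω : List ℕ → ℕ × Γ |
        subtree 0 ω ∈ if x * (ω []).2 = y then Set.univ else ∅} := by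
      ext ω
      simp only [visitSet, List.reverse_nil, alive, posG, mul_one, true_and, Set.mem_ofPred_eq]
      split_ifs with h <;> simp [h]
    rw [this, measure_subtree_mem p hS 0
      (D := fun a : ℕ × Γ => if x * a.2 = y then Set.univ else ∅) fun a => by
        split_ifs
        exacts [MeasurableSet.univ, MeasurableSet.empty]]
    simp only [List.map_nil, List.prod_nil, one_mul, List.length_nil, zero_add,
      Function.iterate_one]
    rw [ofReal_leftAverage_inv hS hsymm h0]
    congr 1
    refine Finset.sum_congr rfl fun s _ => ?_
    simp only [Pi.single_apply, inv_inj]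
    by_cases h : x * s = y <;> simp [h, p.tsum_coe]
  | cons i u ih =>
    rw [visitSet_cons, measure_subtree_mem p hS i
      (D := fun a : ℕ × Γ => if i < a.1 then visitSet u (x * a.2) y else ∅) fun a => by
        split_ifs
        exacts [measurableSet_visitSet _ _ _, MeasurableSet.empty]]
    rw [List.length_cons, Function.iterate_succ_apply',
      ofReal_leftAverage_inv hS hsymm (iterate_leftAverage_nonneg S h0 _), List.map_cons,
      List.prod_cons, mul_left_comm]
    congr 1
    rw [Finset.mul_sum]
    refine Finset.sum_congr rfl fun s _ => ?_
    rw [mul_assoc, ← ih, ← ENNReal.tsum_mul_right]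
    refine tsum_congr fun k => ?_
    dsimp only
    split_ifs <;> simp

lemma tsum_list_prod_map (w : ℕ → ℝ≥0∞) :
    ∑' u : List ℕ, (u.map w).prod = (1 - ∑' i, w i)⁻¹ := by
  have hn : ∀ n : ℕ, ∑' u : List ℕ, (if u.length = n then (u.map w).prod else 0) =
      (∑' i, w i) ^ n := by
    intro n
    induction n with
    | zero =>
      rw [tsum_eq_single [] fun u hu => if_neg (by simpa using hu)]
      simp
    | succ n ih =>
      have hinj : Function.Injective fun q : ℕ × List ℕ => q.1 :: q.2 := by
        rintro ⟨i, u⟩ ⟨j, v⟩ h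
        simpa using h
      rw [← hinj.tsum_eq, ENNReal.tsum_prod', pow_succ', ← ENNReal.tsum_mul_right]
      · refine tsum_congr fun i => ?_
        rw [← ih, ← ENNReal.tsum_mul_left]
        refine tsum_congr fun u => ?_
        simp
      · rintro (_ | ⟨i, u⟩) hu
        · simp at hu
        · exact ⟨(i, u), rfl⟩
  rw [← ENNReal.tsum_geometric, ← tsum_congr hn, ENNReal.tsum_comm]
  refine tsum_congr fun u => ?_
  rw [tsum_eq_single u.length fun n hn => if_neg hn.symm, if_pos rfl]

lemma tsum_tail (p : ℕ → ℝ≥0∞) :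
    ∑' i, ∑' k, (if i < k then p k else 0) = ∑' k : ℕ, (k : ℝ≥0∞) * p k := by
  rw [ENNReal.tsum_comm]
  refine tsum_congr fun k => ?_
  rw [tsum_eq_sum (s := Finset.range k) fun i hi => if_neg (by simpa using hi),
    Finset.sum_congr rfl fun i hi => if_pos (by simpa using hi)]
  simp

/-- A branching random walk is transient when its mean offspring is smaller than the inverse of
the decay rate of the random walk. -/
lemma not_brwRecurrent_of_mul_lt_one {Γ : Type*} [Group Γ] [DecidableEq Γ] [MeasurableSpace Γ]
    [MeasurableSingletonClass Γ] [Countable Γ] (p : PMF ℕ) {S : Finset Γ} (hS : S.Nonempty)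
    (hsymm : ∀ s ∈ S, s⁻¹ ∈ S) {q : ℝ} (hq0 : 0 ≤ q)
    (hq : ∀ (n : ℕ) (y x : Γ), (leftAverage S)^[n] (Pi.single y 1) x ≤ q ^ n)
    (hpq : (∑' k : ℕ, (k : ℝ≥0∞) * p k) * ENNReal.ofReal q < 1) :
    ¬ BRWRecurrent (Measure.infinitePi fun _ : List ℕ => p.toMeasure.prod (unifS S)) := by
  have := isProbabilityMeasure_unifS hS
  set π := Measure.infinitePi fun _ : List ℕ => p.toMeasure.prod (unifS S) with hπ
  set w : ℕ → ℝ≥0∞ := fun i => (∑' k, if i < k then p k else 0) * ENNReal.ofReal q with hw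
  have hsum : ∀ y : Γ, ∑' u, π (visitSet u 1 y) ≠ ∞ := by
    intro y
    have hle : ∀ u, π (visitSet u 1 y) ≤ (u.map w).prod * ENNReal.ofReal q := by
      intro u
      rw [measure_visitSet p hS hsymm, hw, List.prod_map_mul, List.map_const', List.prod_replicate,
        mul_assoc, ← pow_succ, ← ENNReal.ofReal_pow hq0]
      gcongr
      exact hq _ _ _
    refine ne_top_of_le_ne_top ?_ (ENNReal.tsum_le_tsum hle)
    rw [ENNReal.tsum_mul_right, tsum_list_prod_map, hw, ENNReal.tsum_mul_right, tsum_tail]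
    refine ENNReal.mul_ne_top (ENNReal.inv_ne_top.2 ?_) ENNReal.ofReal_ne_top
    exact (tsub_pos_of_lt hpq).ne'
  have hae : ∀ᵐ ω ∂π, ∀ y : Γ, {u | ω ∈ visitSet u 1 y}.Finite :=
    ae_all_iff.2 fun y => ae_finite_setOfPred_mem (hsum y)
  refine not_lt.2 (le_of_eq (measure_mono_null (fun ω hω => ?_) hae))
  obtain ⟨x, hx⟩ := hω
  intro hfin
  refine hx ((hfin ((ω []).2 * x)).image List.reverse |>.subset ?_)
  rintro v ⟨hv, rfl⟩
  exact ⟨v.reverse, by simpa [visitSet] using hv, List.reverse_reverse v⟩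

lemma exists_pmf_of_lt_one {q : ℝ} (hq0 : 0 ≤ q) (hq1 : q < 1) :
    ∃ p : PMF ℕ, p 0 = 0 ∧ p 1 < 1 ∧ 1 < ∑' k : ℕ, (k : ℝ≥0∞) * p k ∧
      (∑' k : ℕ, (k : ℝ≥0∞) * p k) * ENNReal.ofReal q < 1 := by
  set e : ℝ := (1 - q) / 2 with he
  have he0 : 0 < e := by linarith
  have he1 : 0 < 1 - e := by linarith
  set f : ℕ → ℝ≥0∞ := fun k =>
    if k = 1 then ENNReal.ofReal (1 - e) else if k = 2 then ENNReal.ofReal e else 0 with hf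
  have hf0 : ∀ k ∉ ({1, 2} : Finset ℕ), f k = 0 := by
    intro k hk
    simp only [Finset.mem_insert, Finset.mem_singleton, not_or] at hk
    simp [hf, hk.1, hk.2]
  have hsum : ∑ k ∈ ({1, 2} : Finset ℕ), f k = 1 := by
    rw [Finset.sum_pair (by norm_num)]
    simp only [hf, if_true, OfNat.ofNat_ne_one, if_false]
    rw [← ENNReal.ofReal_add he1.le he0.le]
    simp
  have hmean : ∑' k : ℕ, (k : ℝ≥0∞) * PMF.ofFinset f _ hsum hf0 k = ENNReal.ofReal (1 + e) := by
    rw [tsum_eq_sum (s := {1, 2}) fun k hk => by rw [PMF.ofFinset_apply, hf0 k hk, mul_zero],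
      Finset.sum_pair (by norm_num), PMF.ofFinset_apply, PMF.ofFinset_apply]
    simp only [hf, if_true, OfNat.ofNat_ne_one, if_false]
    rw [← ENNReal.ofReal_natCast, ← ENNReal.ofReal_natCast, ← ENNReal.ofReal_mul (by simp),
      ← ENNReal.ofReal_mul (by simp), ← ENNReal.ofReal_add (by simpa using he1.le)
      (by simpa using he0.le)]
    congr 1
    push_cast
    ring
  refine ⟨PMF.ofFinset f _ hsum hf0, ?_, ?_, ?_, ?_⟩
  · simp [hf]
  · simp only [PMF.ofFinset_apply, hf, if_true, ENNReal.ofReal_lt_one]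
    linarith
  · rw [hmean, ENNReal.one_lt_ofReal]
    linarith
  · rw [hmean, ← ENNReal.ofReal_mul (by linarith), ENNReal.ofReal_lt_one, he]
    nlinarith [mul_pos (sub_pos.2 hq1) (show (0 : ℝ) < 2 - q by linarith)]

lemma isAmenableGrp_of_subsingleton {Γ : Type*} [Group Γ] [DecidableEq Γ] [Subsingleton Γ] :
    IsAmenableGrp Γ := by
  refine fun T ε hε => ⟨{1}, Finset.singleton_nonempty 1, fun g _ => ?_⟩
  rw [Finset.image_singleton, Subsingleton.elim (g * 1) 1, symmDiff_self]
  simpa using hε.le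

lemma exists_symmetric_generating {Γ : Type*} [Group Γ] [DecidableEq Γ] [Nontrivial Γ]
    {S₀ : Finset Γ} (hgen₀ : Subgroup.closure (S₀ : Set Γ) = ⊤) :
    ∃ S : Finset Γ, S.Nonempty ∧ (∀ s ∈ S, s⁻¹ ∈ S) ∧ (1 : Γ) ∉ S ∧
      Subgroup.closure (S : Set Γ) = ⊤ := by
  have hS : Subgroup.closure (((S₀ ∪ S₀.image (·⁻¹)).erase 1 : Finset Γ) : Set Γ) = ⊤ := by
    rw [eq_top_iff, ← hgen₀, Subgroup.closure_le]
    intro s hs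
    by_cases h : s = 1
    · rw [h]
      exact one_mem _
    · refine Subgroup.subset_closure ?_
      simp only [Finset.coe_erase, Finset.coe_union, Set.mem_sdiff, Set.mem_union]
      exact ⟨Or.inl hs, h⟩
  refine ⟨_, ?_, fun s hs => ?_, Finset.notMem_erase _ _, hS⟩
  · rw [Finset.nonempty_iff_ne_empty]
    intro h
    rw [h, Finset.coe_empty, Subgroup.closure_empty] at hS
    exact bot_ne_top hS
  · simp only [Finset.mem_erase, Finset.mem_union, Finset.mem_image] at hs ⊢
    refine ⟨by simpa using hs.1, ?_⟩
    rcases hs.2 with h | ⟨t, ht, rfl⟩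
    · exact Or.inr ⟨s, h, rfl⟩
    · exact Or.inl (by simpa using ht)

lemma countable_of_closure_eq_top {Γ : Type*} [Group Γ] {S₀ : Finset Γ}
    (hgen₀ : Subgroup.closure (S₀ : Set Γ) = ⊤) : Countable Γ := by
  have : Countable (FreeGroup S₀) := inferInstanceAs (Countable (Quot _))
  refine Function.Surjective.countable (f := FreeGroup.lift fun s : S₀ => (s : Γ)) ?_
  rw [← MonoidHom.range_eq_top, FreeGroup.range_lift_eq_closure, ← hgen₀]
  simp

/-- A finitely generated group is amenable if and only if every
branching random walk with mean offspring `m > 1` on (any of) its Cayley graphs is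
recurrent. -/
theorem amenable_iff_every_brw_recurrent
    (Γ : Type*) [Group Γ] [DecidableEq Γ] [MeasurableSpace Γ] [MeasurableSingletonClass Γ]
    (S₀ : Finset Γ) (hgen₀ : Subgroup.closure (S₀ : Set Γ) = ⊤) :
    IsAmenableGrp Γ ↔
      ∀ S : Finset Γ, S.Nonempty → (∀ s ∈ S, s⁻¹ ∈ S) → (1 : Γ) ∉ S →
        Subgroup.closure (S : Set Γ) = ⊤ →
        ∀ p : PMF ℕ, p 0 = 0 → p 1 < 1 → 1 < ∑' k : ℕ, (k : ℝ≥0∞) * p k →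
          ∀ P : Measure (List ℕ → ℕ × Γ),
            IsProductWith (fun _ : List ℕ => (p.toMeasure).prod (unifS S)) P →
              BRWRecurrent P := by
  have : Countable Γ := countable_of_closure_eq_top hgen₀
  constructor
  · intro hΓ S hS hsymm _ _ p _ _ hm P hP
    have := isProbabilityMeasure_unifS hS
    rw [hP.eq_infinitePi]
    exact brwRecurrent_of_isAmenableGrp hΓ hS hsymm p hm
  · intro h
    by_contra hΓ
    rcases subsingleton_or_nontrivial Γ with _ | _
    · exact hΓ isAmenableGrp_of_subsingleton
    obtain ⟨S, hS, hsymm, h1, hgen⟩ := exists_symmetric_generating hgen₀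
    obtain ⟨q, hq0, hq1, hq⟩ := exists_iterate_leftAverage_le hΓ hS hsymm hgen
    obtain ⟨p, hp0, hp1, hm, hpq⟩ := exists_pmf_of_lt_one hq0 hq1
    have := isProbabilityMeasure_unifS hS
    exact not_brwRecurrent_of_mul_lt_one p hS hsymm hq0 hq hpq
      (h S hS hsymm h1 hgen p hp0 hp1 hm _ (isProductWith_infinitePi _))
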